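/- Let 𝐗 = (X,𝕏) be a level-2 α-Hölder rough path over V, let 𝐘 = (Y,Y') be an 𝐗-controlled rough path with values in L(W,U) and let 𝐙 = (Z,Z') be an 𝐗-controlled rough path with values in W. If P and P' are finite partitions of an interval [s,t] ⊆ [0,T] such that P' refines P (every point of P is a point of P'), then ‖∫_{P'} Y dZ − ∫_P Y dZ‖ ≤ C_α (‖Y'_0‖ + ‖𝐘‖_{𝐗;α}) (‖Z'_0‖ + ‖𝐙‖_{𝐗;α}) (1 + ‖𝐗‖_α)² |P|^{3α−1} (t − s), where |P| is the mesh of P. -/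

import Mathlib

/-!  Common definitions: level-2 rough paths, controlled rough paths,
compensated Riemann sums and rough integrals of a controlled rough path
against another controlled rough path. -/

open scoped BigOperators

noncomputable section

/-- `HBound T β A` : the two-parameter map `A` satisfies a `β`-Hölder bound on the
simplex `{0 ≤ s < t ≤ T}`. -/
def HBound {E : Type*} [NormedAddCommGroup E] (T β : ℝ) (A : ℝ → ℝ → E) : Prop :=
  ∃ C : ℝ, ∀ s t : ℝ, 0 ≤ s → s < t → t ≤ T → ‖A s t‖ ≤ C * (t - s) ^ β

/-- The Hölder seminorm `‖A‖_β = sup_{0 ≤ s < t ≤ T} ‖A_{s,t}‖ / (t-s)^β`, realised as the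
least admissible Hölder constant. -/
def hnorm {E : Type*} [NormedAddCommGroup E] (T β : ℝ) (A : ℝ → ℝ → E) : ℝ :=
  sInf {C : ℝ | 0 ≤ C ∧ ∀ s t : ℝ, 0 ≤ s → s < t → t ≤ T → ‖A s t‖ ≤ C * (t - s) ^ β}

/-- An abstract model of the projective tensor product `V ⊗̂ V`, bundling the canonical
bounded bilinear map `tmul : V × V → V ⊗̂ V` and the pairing `⋆` sending
`A ∈ L(V, L(W,U))` and `B ∈ L(V,W)` to the induced operator `A ⋆ B ∈ L(V ⊗̂ V, U)`,
characterised by `(A ⋆ B)(v₁ ⊗ v₂) = (A v₁)(B v₂)` and `‖A ⋆ B‖ ≤ ‖A‖ ‖B‖`. -/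
structure TensorOps (V V2 W U : Type*)
    [NormedAddCommGroup V] [NormedSpace ℝ V] [NormedAddCommGroup V2] [NormedSpace ℝ V2]
    [NormedAddCommGroup W] [NormedSpace ℝ W] [NormedAddCommGroup U] [NormedSpace ℝ U] where
  tmul : V →L[ℝ] V →L[ℝ] V2
  tmul_le : ∀ a b : V, ‖tmul a b‖ ≤ ‖a‖ * ‖b‖
  spair : (V →L[ℝ] (W →L[ℝ] U)) →L[ℝ] ((V →L[ℝ] W) →L[ℝ] (V2 →L[ℝ] U))
  spair_tmul : ∀ (A : V →L[ℝ] (W →L[ℝ] U)) (B : V →L[ℝ] W) (a b : V),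
    spair A B (tmul a b) = (A a) (B b)
  spair_le : ∀ (A : V →L[ℝ] (W →L[ℝ] U)) (B : V →L[ℝ] W), ‖spair A B‖ ≤ ‖A‖ * ‖B‖

section Defs

variable {V V2 E : Type*}
  [NormedAddCommGroup V] [NormedSpace ℝ V] [NormedAddCommGroup V2] [NormedSpace ℝ V2]
  [NormedAddCommGroup E] [NormedSpace ℝ E]

/-- `(X, XX)` is a level-2 `α`-Hölder rough path on `[0,T]`:
Chen's relation plus the analytic estimates. -/
structure IsRoughPath (T α : ℝ) (tmul : V →L[ℝ] V →L[ℝ] V2)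
    (X : ℝ → V) (XX : ℝ → ℝ → V2) : Prop where
  chen : ∀ s u t : ℝ, 0 ≤ s → s ≤ u → u ≤ t → t ≤ T →
    XX s t = XX s u + XX u t + tmul (X u - X s) (X t - X u)
  x_hold : HBound T α fun s t => X t - X s
  xx_hold : HBound T (2 * α) XX

/-- `‖𝐗‖_α := ‖X‖_α + ‖𝕏‖_{2α}`. -/
def rpNorm (T α : ℝ) (X : ℝ → V) (XX : ℝ → ℝ → V2) : ℝ :=
  hnorm T α (fun s t => X t - X s) + hnorm T (2 * α) XX

/-- `‖𝐗 − 𝐗̃‖_α := ‖X − X̃‖_α + ‖𝕏 − 𝕏̃‖_{2α}`. -/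
def rpDist (T α : ℝ) (X Xt : ℝ → V) (XX XXt : ℝ → ℝ → V2) : ℝ :=
  hnorm T α (fun s t => (X t - X s) - (Xt t - Xt s)) +
    hnorm T (2 * α) fun s t => XX s t - XXt s t

/-- The remainder `R^{𝐘}_{s,t} := Y_{s,t} − Y'_s(X_{s,t})` of a controlled rough path. -/
def Rem (X : ℝ → V) (Y : ℝ → E) (Y' : ℝ → V →L[ℝ] E) (s t : ℝ) : E :=
  Y t - Y s - Y' s (X t - X s)

/-- `(Y, Y')` is an `𝐗`-controlled rough path on `[0,T]` with values in `E`. -/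
structure IsCRP (T α : ℝ) (X : ℝ → V) (Y : ℝ → E) (Y' : ℝ → V →L[ℝ] E) : Prop where
  deriv_hold : HBound T α fun s t => Y' t - Y' s
  rem_hold : HBound T (2 * α) (Rem X Y Y')

/-- `‖𝐘‖_{𝐗;α} := ‖R^{𝐘}‖_{2α} + ‖Y'‖_α`. -/
def crpNorm (T α : ℝ) (X : ℝ → V) (Y : ℝ → E) (Y' : ℝ → V →L[ℝ] E) : ℝ :=
  hnorm T (2 * α) (Rem X Y Y') + hnorm T α fun s t => Y' t - Y' s

/-- `d_{𝐗,𝐗̃;α}(𝐘,𝐘̃) := ‖R^{𝐘} − R^{𝐘̃}‖_{2α} + ‖Y' − Ỹ'‖_α`. -/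
def crpDist (T α : ℝ) (X Xt : ℝ → V) (Y : ℝ → E) (Y' : ℝ → V →L[ℝ] E)
    (Yt : ℝ → E) (Yt' : ℝ → V →L[ℝ] E) : ℝ :=
  hnorm T (2 * α) (fun s t => Rem X Y Y' s t - Rem Xt Yt Yt' s t) +
    hnorm T α fun s t => (Y' t - Y' s) - (Yt' t - Yt' s)

/-- `p` is a finite partition `s = p 0 < p 1 < ⋯ < p n = t` of `[s,t]`. -/
def IsPartition (s t : ℝ) (n : ℕ) (p : ℕ → ℝ) : Prop :=
  p 0 = s ∧ p n = t ∧ ∀ i < n, p i < p (i + 1)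

end Defs

section Sums

variable {V V2 W U : Type*}
  [NormedAddCommGroup V] [NormedSpace ℝ V] [NormedAddCommGroup V2] [NormedSpace ℝ V2]
  [NormedAddCommGroup W] [NormedSpace ℝ W] [NormedAddCommGroup U] [NormedSpace ℝ U]

/-- The compensated Riemann sum
`∫_P Y dZ := Σ_i [ Y_{t_i}(Z_{t_i,t_{i+1}}) + (Y'_{t_i} ⋆ Z'_{t_i})(𝕏_{t_i,t_{i+1}}) ]`. -/
def rsum (tops : TensorOps V V2 W U) (XX : ℝ → ℝ → V2)
    (Y : ℝ → W →L[ℝ] U) (Y' : ℝ → V →L[ℝ] (W →L[ℝ] U))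
    (Z : ℝ → W) (Z' : ℝ → V →L[ℝ] W) (n : ℕ) (p : ℕ → ℝ) : U :=
  ∑ i ∈ Finset.range n,
    ((Y (p i)) (Z (p (i + 1)) - Z (p i)) +
      (tops.spair (Y' (p i)) (Z' (p i))) (XX (p i) (p (i + 1))))

/-- `I` is the rough integral `∫_s^t Y dZ`: the limit of the compensated Riemann sums
as the mesh of the partition tends to `0`. -/
def IsRoughIntegral (tops : TensorOps V V2 W U) (XX : ℝ → ℝ → V2)
    (Y : ℝ → W →L[ℝ] U) (Y' : ℝ → V →L[ℝ] (W →L[ℝ] U))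
    (Z : ℝ → W) (Z' : ℝ → V →L[ℝ] W) (s t : ℝ) (I : U) : Prop :=
  ∀ ε : ℝ, 0 < ε → ∃ δ : ℝ, 0 < δ ∧ ∀ (n : ℕ) (p : ℕ → ℝ), IsPartition s t n p →
    (∀ i < n, p (i + 1) - p i < δ) → ‖rsum tops XX Y Y' Z Z' n p - I‖ ≤ ε

end Sums

/-- The constant `C_α := (1 + T^α + T^{2α}) · 2^{3α} · Σ_{n≥1} n^{-3α}`. -/
def Calpha (T α : ℝ) : ℝ :=
  (1 + T ^ α + T ^ (2 * α)) * (2 : ℝ) ^ (3 * α) * ∑' n : ℕ, ((n : ℝ) + 1) ^ (-(3 * α))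

/-- `F ∈ C_b^k`: `k` times continuously Fréchet differentiable with all derivatives
up to order `k` bounded. -/
def IsCb {E₁ E₂ : Type*} [NormedAddCommGroup E₁] [NormedSpace ℝ E₁]
    [NormedAddCommGroup E₂] [NormedSpace ℝ E₂] (k : ℕ) (F : E₁ → E₂) : Prop :=
  ContDiff ℝ (k : ℕ∞) F ∧ ∀ j ≤ k, ∃ C : ℝ, ∀ x, ‖iteratedFDeriv ℝ j F x‖ ≤ C

/-- `‖F‖_{C_b^k} := Σ_{j=0}^k sup_x ‖D^j F(x)‖`. -/
def cbNorm {E₁ E₂ : Type*} [NormedAddCommGroup E₁] [NormedSpace ℝ E₁]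
    [NormedAddCommGroup E₂] [NormedSpace ℝ E₂] (k : ℕ) (F : E₁ → E₂) : ℝ :=
  ∑ j ∈ Finset.range (k + 1), ⨆ x : E₁, ‖iteratedFDeriv ℝ j F x‖

end

lemma hnorm_nonneg {E : Type*} [NormedAddCommGroup E] (T β : ℝ) (A : ℝ → ℝ → E) :
    0 ≤ hnorm T β A :=
  Real.sInf_nonneg fun _ h => h.1

lemma HBound.norm_le {E : Type*} [NormedAddCommGroup E] {T β : ℝ} {A : ℝ → ℝ → E}
    (h : HBound T β A) {s t : ℝ} (hs : 0 ≤ s) (hst : s < t) (ht : t ≤ T) :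
    ‖A s t‖ ≤ hnorm T β A * (t - s) ^ β := by
  have hpos : 0 < (t - s) ^ β := Real.rpow_pos_of_pos (sub_pos.2 hst) β
  rw [← div_le_iff₀ hpos]
  obtain ⟨C, hC⟩ := h
  refine le_csInf ⟨max C 0, le_max_right _ _, fun a b ha hab hb => (hC a b ha hab hb).trans ?_⟩ ?_
  · exact mul_le_mul_of_nonneg_right (le_max_left _ _)
      (Real.rpow_nonneg (sub_nonneg.2 hab.le) _)
  · rintro D ⟨-, hD⟩
    exact (div_le_iff₀ hpos).2 (hD s t hs hst ht)

lemma HBound.norm_le_mul {E : Type*} [NormedAddCommGroup E] {T β : ℝ} {A : ℝ → ℝ → E}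
    (h : HBound T β A) {s t ρ : ℝ} (hs : 0 ≤ s) (hst : s < t) (ht : t ≤ T)
    (hρ : (t - s) ^ β ≤ ρ) : ‖A s t‖ ≤ hnorm T β A * ρ :=
  (h.norm_le hs hst ht).trans (mul_le_mul_of_nonneg_left hρ (hnorm_nonneg T β A))

/-- A path whose increments are Hölder is bounded by its initial value and its seminorm. -/
lemma HBound.norm_path_le {E : Type*} [NormedAddCommGroup E] {T β : ℝ} {f : ℝ → E}
    (hβ : 0 ≤ β) (h : HBound T β fun s t => f t - f s) {s : ℝ} (hs : 0 ≤ s) (hsT : s ≤ T) :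
    ‖f s‖ ≤ ‖f 0‖ + hnorm T β (fun s t => f t - f s) * T ^ β := by
  rcases hs.eq_or_lt with rfl | hs'
  · have := mul_nonneg (hnorm_nonneg T β fun s t => f t - f s) (Real.rpow_nonneg hsT β)
    linarith
  · have h1 := h.norm_le_mul le_rfl hs' hsT
      (Real.rpow_le_rpow (by linarith) (by linarith : s - 0 ≤ T) hβ)
    calc ‖f s‖ = ‖f 0 + (f s - f 0)‖ := by rw [add_sub_cancel]
      _ ≤ _ := (norm_add_le _ _).trans (by gcongr)

lemma IsPartition.strict {s t : ℝ} {n : ℕ} {p : ℕ → ℝ} (hp : IsPartition s t n p)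
    {i j : ℕ} (hij : i < j) (hj : j ≤ n) : p i < p j := by
  induction j, hij using Nat.le_induction with
  | base => exact hp.2.2 i (by omega)
  | succ j _ ih => exact (ih (by omega)).trans (hp.2.2 j (by omega))

lemma IsPartition.le {s t : ℝ} {n : ℕ} {p : ℕ → ℝ} (hp : IsPartition s t n p)
    {i j : ℕ} (hij : i ≤ j) (hj : j ≤ n) : p i ≤ p j := by
  rcases hij.eq_or_lt with rfl | h
  · exact le_rfl
  · exact (hp.strict h hj).le

/-- The part of a partition between two of its points. -/
lemma IsPartition.shift {s t : ℝ} {n : ℕ} {p : ℕ → ℝ} (hp : IsPartition s t n p)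
    {k d : ℕ} (h : k + d ≤ n) : IsPartition (p k) (p (k + d)) d fun j => p (k + j) :=
  ⟨rfl, rfl, fun j hj => hp.2.2 (k + j) (by omega)⟩

/-- Removing an interior point from a partition. -/
lemma IsPartition.remove {s t : ℝ} {n k : ℕ} {p : ℕ → ℝ} (hp : IsPartition s t (n + 1) p)
    (hk : k < n) : IsPartition s t n fun j => if j ≤ k then p j else p (j + 1) := by
  refine ⟨by simpa using hp.1, ?_, fun i hi => ?_⟩
  · simpa [not_le.2 hk] using hp.2.1
  · dsimp only
    split_ifs <;> first | omega | exact hp.strict (by omega) (by omega)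

/-- Some interior point has neighbours at distance at most twice the average. -/
lemma IsPartition.exists_close {s t : ℝ} {n : ℕ} {p : ℕ → ℝ}
    (hp : IsPartition s t (n + 1) p) (hn : 0 < n) :
    ∃ k < n, p (k + 2) - p k ≤ 2 * (t - s) / n := by
  have hn' : (0 : ℝ) < n := by exact_mod_cast hn
  have hsum : ∑ k ∈ Finset.range n, (p (k + 2) - p k)
      ≤ ∑ _k ∈ Finset.range n, 2 * (t - s) / n := by
    have h1 := Finset.sum_range_sub (fun k => p (k + 1)) n
    have h2 := Finset.sum_range_sub p n
    have h3 : ∑ k ∈ Finset.range n, (p (k + 2) - p k) =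
        ∑ k ∈ Finset.range n, (p (k + 1 + 1) - p (k + 1)) +
          ∑ k ∈ Finset.range n, (p (k + 1) - p k) := by
      rw [← Finset.sum_add_distrib]
      exact Finset.sum_congr rfl fun k _ => by ring
    rw [h3, h1, h2, Finset.sum_const, Finset.card_range, nsmul_eq_mul,
      mul_div_cancel₀ _ hn'.ne']
    have h4 := hp.le (Nat.le_succ n) le_rfl
    have h5 := hp.le (Nat.zero_le 1) (by omega)
    have h6 := hp.1
    have h7 := hp.2.1
    simp only [Nat.succ_eq_add_one] at h4
    simp only [zero_add]
    linarith
  obtain ⟨k, hk, h⟩ := Finset.exists_le_of_sum_le (Finset.nonempty_range_iff.2 hn.ne') hsum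
  exact ⟨k, Finset.mem_range.1 hk, h⟩

lemma sum_sub_sum_remove {U : Type*} [AddCommGroup U] (Ξ : ℝ → ℝ → U) (p : ℕ → ℝ) {n k : ℕ}
    (hk : k < n) :
    ∑ i ∈ Finset.range (n + 1), Ξ (p i) (p (i + 1)) -
        ∑ i ∈ Finset.range n, Ξ (if i ≤ k then p i else p (i + 1))
          (if i + 1 ≤ k then p (i + 1) else p (i + 1 + 1)) =
      Ξ (p k) (p (k + 1)) + Ξ (p (k + 1)) (p (k + 2)) - Ξ (p k) (p (k + 2)) := by
  obtain ⟨l, rfl⟩ : ∃ l, n = k + 1 + l := ⟨n - (k + 1), by omega⟩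
  rw [show k + 1 + l + 1 = k + 2 + l by omega, Finset.sum_range_add, Finset.sum_range_add,
    Finset.sum_range_add _ (k + 1) l, Finset.sum_range_succ _ k, Finset.sum_range_succ _ 1,
    Finset.sum_range_one]
  have h1 : ∑ i ∈ Finset.range k, Ξ (if i ≤ k then p i else p (i + 1))
      (if i + 1 ≤ k then p (i + 1) else p (i + 1 + 1)) =
      ∑ i ∈ Finset.range k, Ξ (p i) (p (i + 1)) := by
    refine Finset.sum_congr rfl fun i hi => ?_
    have := Finset.mem_range.1 hi
    rw [if_pos (by omega), if_pos (by omega)]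
  have h2 : ∑ i ∈ Finset.range l, Ξ (if k + 1 + i ≤ k then p (k + 1 + i) else p (k + 1 + i + 1))
      (if k + 1 + i + 1 ≤ k then p (k + 1 + i + 1) else p (k + 1 + i + 1 + 1)) =
      ∑ i ∈ Finset.range l, Ξ (p (k + 2 + i)) (p (k + 2 + i + 1)) := by
    refine Finset.sum_congr rfl fun i _ => ?_
    rw [if_neg (by omega), if_neg (by omega), show k + 1 + i + 1 = k + 2 + i by omega]
  rw [h1, h2, if_pos le_rfl, if_neg (by omega)]
  simp only [add_zero, add_assoc, Nat.reduceAdd]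
  abel

/-- Young's point-removal argument. -/
lemma norm_sum_sub_le_of_defect {U : Type*} [NormedAddCommGroup U] {Ξ : ℝ → ℝ → U}
    {K θ a b : ℝ} (hK : 0 ≤ K) (hθ : 0 ≤ θ)
    (hΞ : ∀ s u t, a ≤ s → s < u → u < t → t ≤ b →
      ‖Ξ s u + Ξ u t - Ξ s t‖ ≤ K * (t - s) ^ θ)
    (n : ℕ) (p : ℕ → ℝ) (hp : IsPartition a b (n + 1) p) :
    ‖∑ i ∈ Finset.range (n + 1), Ξ (p i) (p (i + 1)) - Ξ a b‖ ≤
      K * (2 ^ θ * ∑ j ∈ Finset.range n, ((j : ℝ) + 1) ^ (-θ)) * (b - a) ^ θ := by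
  induction n generalizing p with
  | zero =>
    have h1 := hp.1
    have h2 := hp.2.1
    simp only [zero_add] at h2
    simp [h1, h2]
  | succ n ih =>
    obtain ⟨k, hk, hclose⟩ := hp.exists_close n.succ_pos
    have hk2 : p k ≤ p (k + 2) := hp.le (by omega) (by omega)
    have hab : a ≤ b := by
      rw [← hp.1, ← hp.2.1]; exact hp.le (Nat.zero_le _) le_rfl
    have hdef := hΞ (p k) (p (k + 1)) (p (k + 2)) (hp.1 ▸ hp.le (Nat.zero_le k) (by omega))
      (hp.strict (by omega) (by omega)) (hp.strict (by omega) (by omega))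
      (hp.2.1 ▸ hp.le (by omega) le_rfl)
    have hpow : (p (k + 2) - p k) ^ θ ≤ 2 ^ θ * ((n : ℝ) + 1) ^ (-θ) * (b - a) ^ θ := by
      have hn : (0 : ℝ) ≤ (n : ℝ) + 1 := by positivity
      refine (Real.rpow_le_rpow (sub_nonneg.2 hk2) hclose hθ).trans_eq ?_
      push_cast
      rw [Real.div_rpow (by linarith) hn, Real.mul_rpow two_pos.le (sub_nonneg.2 hab),
        Real.rpow_neg hn]
      ring
    have hih := ih _ (hp.remove hk)
    have hrem := sum_sub_sum_remove Ξ p hk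
    rw [← hrem] at hdef
    calc _ = ‖_ + _‖ := by rw [sub_add_sub_cancel]
      _ ≤ _ := (norm_add_le _ _).trans (add_le_add hdef hih)
      _ ≤ K * (2 ^ θ * ((n : ℝ) + 1) ^ (-θ) * (b - a) ^ θ) + _ := by gcongr
      _ = _ := by rw [Finset.sum_range_succ]; ring

/-- Almost additive two-parameter maps have Riemann sums that are stable under refinement. -/
lemma norm_sum_refinement_sub_le {U : Type*} [NormedAddCommGroup U] {Ξ : ℝ → ℝ → U}
    {K θ s t : ℝ} (hK : 0 ≤ K) (hθ : 1 < θ)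
    (hΞ : ∀ a u b, s ≤ a → a < u → u < b → b ≤ t →
      ‖Ξ a u + Ξ u b - Ξ a b‖ ≤ K * (b - a) ^ θ)
    {n : ℕ} {p : ℕ → ℝ} (hp : IsPartition s t n p)
    {n' : ℕ} {p' : ℕ → ℝ} (hp' : IsPartition s t n' p')
    (href : ∀ i ≤ n, ∃ k ≤ n', p' k = p i)
    {m : ℝ} (hm : ∀ i < n, p (i + 1) - p i ≤ m) :
    ‖∑ i ∈ Finset.range n', Ξ (p' i) (p' (i + 1)) - ∑ i ∈ Finset.range n, Ξ (p i) (p (i + 1))‖ ≤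
      K * (2 ^ θ * ∑' j : ℕ, ((j : ℝ) + 1) ^ (-θ)) * m ^ (θ - 1) * (t - s) := by
  have hsummable : Summable fun j : ℕ => ((j : ℝ) + 1) ^ (-θ) := by
    have h := (summable_nat_add_iff 1).2 (Real.summable_nat_rpow.2 (by linarith : -θ < -1))
    simpa using h
  set S := ∑' j : ℕ, ((j : ℝ) + 1) ^ (-θ)
  have hpart (d : ℕ) : ∑ j ∈ Finset.range d, ((j : ℝ) + 1) ^ (-θ) ≤ S :=
    hsummable.sum_le_tsum _ fun j _ => by positivity
  have hS0 : 0 ≤ S := by simpa using hpart 0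
  have hinj {k l : ℕ} (hk : k ≤ n') (hl : l ≤ n') (h : p' k = p' l) : k = l := by
    rcases lt_trichotomy k l with h' | h' | h'
    · exact absurd h (hp'.strict h' hl).ne
    · exact h'
    · exact absurd h (hp'.strict h' hk).ne'
  have key : ∀ i ≤ n, ∀ k ≤ n', p' k = p i →
      ‖∑ j ∈ Finset.range k, Ξ (p' j) (p' (j + 1)) -
        ∑ j ∈ Finset.range i, Ξ (p j) (p (j + 1))‖ ≤
      K * (2 ^ θ * S) * m ^ (θ - 1) * (p i - s) := by
    intro i
    induction i with
    | zero =>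
      intro _ k hk h
      obtain rfl : k = 0 := hinj hk (Nat.zero_le _) (by rw [h, hp.1, hp'.1])
      simp [hp.1]
    | succ i ih =>
      intro hi l hl h
      obtain ⟨k, hk, hki⟩ := href i (by omega)
      have hlt : p i < p (i + 1) := hp.2.2 i hi
      have hkl : k < l := by
        by_contra hcon
        have := hp'.le (not_lt.1 hcon) hk
        linarith
      obtain ⟨d, rfl⟩ : ∃ d, l = k + (d + 1) := ⟨l - k - 1, by omega⟩
      have hloc := norm_sum_sub_le_of_defect (a := p i) (b := p (i + 1)) hK (by linarith : 0 ≤ θ)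
        (fun a u b ha h1 h2 hb => hΞ a u b
          ((hp.1 ▸ hp.le (Nat.zero_le i) (by omega)).trans ha) h1 h2
          (hb.trans (hp.2.1 ▸ hp.le hi le_rfl)))
        d _ (hki ▸ h ▸ hp'.shift hl)
      have hpow : (p (i + 1) - p i) ^ θ ≤ m ^ (θ - 1) * (p (i + 1) - p i) := by
        have hpos := sub_pos.2 hlt
        calc (p (i + 1) - p i) ^ θ = (p (i + 1) - p i) ^ (θ - 1) * (p (i + 1) - p i) := by
              rw [← Real.rpow_add_one hpos.ne', sub_add_cancel]
          _ ≤ _ := by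
              gcongr
              exact hm i hi
      have hloc' := hloc.trans (mul_le_mul (mul_le_mul_of_nonneg_left
        (mul_le_mul_of_nonneg_left (hpart d) (by positivity)) hK) hpow
        (Real.rpow_nonneg (sub_pos.2 hlt).le _) (by positivity))
      have hih := ih (by omega) k hk hki
      rw [Finset.sum_range_add, Finset.sum_range_succ _ i, add_sub_add_comm]
      refine (norm_add_le _ _).trans ((add_le_add hih hloc').trans_eq ?_)
      ring
  have h := key n le_rfl n' le_rfl (by rw [hp.2.1, hp'.2.1])
  rwa [hp.2.1] at h

/-- The polynomial inequality behind the bound on the additivity defect. -/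
lemma defect_coefficient_le {x1 x2 y0 y1 y2 z0 z1 z2 τ τ2 : ℝ} (hx1 : 0 ≤ x1) (hx2 : 0 ≤ x2)
    (hy0 : 0 ≤ y0) (hy1 : 0 ≤ y1) (hy2 : 0 ≤ y2) (hz0 : 0 ≤ z0) (hz1 : 0 ≤ z1) (hz2 : 0 ≤ z2)
    (hτ : 0 ≤ τ) (hτ2 : 0 ≤ τ2) :
    (y0 + y1 * τ) * (x1 ^ 2 * z1 + x1 * z2 + x2 * z1) + y2 * (z0 + z1 * τ) * x1 +
        y1 * (z0 + z1 * τ) * x2 + y2 * z2 * τ ≤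
      (1 + τ + τ2) * (y0 + (y2 + y1)) * (z0 + (z2 + z1)) * (1 + (x1 + x2)) ^ 2 := by
  have q1 : x1 ^ 2 + 2 * x2 ≤ (1 + (x1 + x2)) ^ 2 := by nlinarith [mul_nonneg hx1 hx2]
  have q2 : x1 ≤ (1 + (x1 + x2)) ^ 2 := by nlinarith [mul_nonneg hx1 hx2]
  have q3 : 1 ≤ (1 + (x1 + x2)) ^ 2 := by nlinarith
  have q4 : x1 ^ 2 + x2 ≤ (1 + (x1 + x2)) ^ 2 := by linarith
  have q5 : x2 ≤ (1 + (x1 + x2)) ^ 2 := by nlinarith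
  generalize (1 + (x1 + x2)) ^ 2 = Q at *
  have hQ : 0 ≤ Q := by linarith
  calc _ = y0 * z1 * (x1 ^ 2 + x2) + y0 * z2 * x1 + y1 * z1 * τ * (x1 ^ 2 + 2 * x2) +
        y1 * z2 * τ * x1 + y2 * z0 * x1 + y2 * z1 * τ * x1 + y2 * z2 * τ * 1 +
        y1 * z0 * x2 := by ring
    _ ≤ y0 * z1 * Q + y0 * z2 * Q + y1 * z1 * τ * Q + y1 * z2 * τ * Q + y2 * z0 * Q +
        y2 * z1 * τ * Q + y2 * z2 * τ * Q + y1 * z0 * Q := by gcongr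
    _ ≤ _ := by
      rw [← sub_nonneg]
      ring_nf
      positivity

/-- The additivity defect of the compensated Riemann summand. -/
lemma norm_compensated_defect_le
    {V V2 W U : Type*} [NormedAddCommGroup V] [NormedSpace ℝ V]
    [NormedAddCommGroup V2] [NormedSpace ℝ V2]
    [NormedAddCommGroup W] [NormedSpace ℝ W]
    [NormedAddCommGroup U] [NormedSpace ℝ U]
    {T α : ℝ} (hα : 0 ≤ α)
    (tops : TensorOps V V2 W U) {X : ℝ → V} {XX : ℝ → ℝ → V2}
    (hX : IsRoughPath T α tops.tmul X XX)
    {Y : ℝ → W →L[ℝ] U} {Y' : ℝ → V →L[ℝ] (W →L[ℝ] U)} (hY : IsCRP T α X Y Y')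
    {Z : ℝ → W} {Z' : ℝ → V →L[ℝ] W} (hZ : IsCRP T α X Z Z')
    {s u t : ℝ} (hs : 0 ≤ s) (hsu : s < u) (hut : u < t) (htT : t ≤ T) :
    ‖(Y s (Z u - Z s) + tops.spair (Y' s) (Z' s) (XX s u)) +
        (Y u (Z t - Z u) + tops.spair (Y' u) (Z' u) (XX u t)) -
        (Y s (Z t - Z s) + tops.spair (Y' s) (Z' s) (XX s t))‖ ≤
      (1 + T ^ α + T ^ (2 * α)) * (‖Y' 0‖ + crpNorm T α X Y Y') *
        (‖Z' 0‖ + crpNorm T α X Z Z') * (1 + rpNorm T α X XX) ^ 2 * (t - s) ^ (3 * α) := by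
  have hr : 0 < t - s := by linarith
  have hT : 0 ≤ T := by linarith
  have hu : 0 ≤ u := by linarith
  have e2 : (t - s) ^ (2 * α) = ((t - s) ^ α) ^ 2 := by
    rw [mul_comm, Real.rpow_mul hr.le]; norm_cast
  have e3 : (t - s) ^ (3 * α) = ((t - s) ^ α) ^ 3 := by
    rw [mul_comm, Real.rpow_mul hr.le]; norm_cast
  have hsu1 : (u - s) ^ α ≤ (t - s) ^ α :=
    Real.rpow_le_rpow (by linarith) (by linarith) hα
  have hut1 : (t - u) ^ α ≤ (t - s) ^ α :=
    Real.rpow_le_rpow (by linarith) (by linarith) hα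
  have hsu2 : (u - s) ^ (2 * α) ≤ ((t - s) ^ α) ^ 2 :=
    e2 ▸ Real.rpow_le_rpow (by linarith) (by linarith) (by linarith)
  have hut2 : (t - u) ^ (2 * α) ≤ ((t - s) ^ α) ^ 2 :=
    e2 ▸ Real.rpow_le_rpow (by linarith) (by linarith) (by linarith)
  have hρτ : (t - s) ^ α ≤ T ^ α := Real.rpow_le_rpow hr.le (by linarith) hα
  have hρ0 : 0 ≤ (t - s) ^ α := Real.rpow_nonneg hr.le _
  have hτ2 : 0 ≤ T ^ (2 * α) := Real.rpow_nonneg hT _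
  have bX1 := hX.x_hold.norm_le_mul hs hsu (hut.le.trans htT) hsu1
  have bX2 := hX.x_hold.norm_le_mul hu hut htT hut1
  have bXX := hX.xx_hold.norm_le_mul hu hut htT hut2
  have bY' := hY.deriv_hold.norm_le_mul hs hsu (hut.le.trans htT) hsu1
  have bZ' := hZ.deriv_hold.norm_le_mul hs hsu (hut.le.trans htT) hsu1
  have bRY := hY.rem_hold.norm_le_mul hs hsu (hut.le.trans htT) hsu2
  have bRZ := hZ.rem_hold.norm_le_mul hu hut htT hut2
  have bYs := hY.deriv_hold.norm_path_le hα hs (by linarith)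
  have bYu := hY.deriv_hold.norm_path_le hα hu (by linarith)
  have bZs := hZ.deriv_hold.norm_path_le hα hs (by linarith)
  have bZu := hZ.deriv_hold.norm_path_le hα hu (by linarith)
  have hx1 := hnorm_nonneg T α fun s t => X t - X s
  have hx2 := hnorm_nonneg T (2 * α) XX
  have hy1 := hnorm_nonneg T α fun s t => Y' t - Y' s
  have hy2 := hnorm_nonneg T (2 * α) (Rem X Y Y')
  have hz1 := hnorm_nonneg T α fun s t => Z' t - Z' s
  have hz2 := hnorm_nonneg T (2 * α) (Rem X Z Z')
  have hy0 := norm_nonneg (Y' 0)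
  have hz0 := norm_nonneg (Z' 0)
  have hid : (Y s (Z u - Z s) + tops.spair (Y' s) (Z' s) (XX s u)) +
        (Y u (Z t - Z u) + tops.spair (Y' u) (Z' u) (XX u t)) -
        (Y s (Z t - Z s) + tops.spair (Y' s) (Z' s) (XX s t)) =
      Y' s (X u - X s) ((Z' u - Z' s) (X t - X u)) + Y' s (X u - X s) (Rem X Z Z' u t) +
        Rem X Y Y' s u (Z' u (X t - X u) + Rem X Z Z' u t) +
        tops.spair (Y' u - Y' s) (Z' s) (XX u t) + tops.spair (Y' u) (Z' u - Z' s) (XX u t) := by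
    rw [hX.chen s u t hs hsu.le hut.le htT]
    simp only [map_add, map_sub, tops.spair_tmul, Rem, sub_apply]
    abel
  rw [hid, e3, crpNorm, crpNorm, rpNorm]
  generalize hnorm T α (fun s t => X t - X s) = x1 at *
  generalize hnorm T (2 * α) XX = x2 at *
  generalize hnorm T α (fun s t => Y' t - Y' s) = y1 at *
  generalize hnorm T (2 * α) (Rem X Y Y') = y2 at *
  generalize hnorm T α (fun s t => Z' t - Z' s) = z1 at *
  generalize hnorm T (2 * α) (Rem X Z Z') = z2 at *
  generalize ‖Y' 0‖ = y0 at *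
  generalize ‖Z' 0‖ = z0 at *
  generalize T ^ (2 * α) = τ2 at *
  generalize T ^ α = τ at *
  generalize (t - s) ^ α = ρ at *
  have hτ : 0 ≤ τ := hρ0.trans hρτ
  have bYX : ‖Y' s (X u - X s)‖ ≤ (y0 + y1 * τ) * (x1 * ρ) := (Y' s).le_of_opNorm_le_of_le bYs bX1
  have c1 := ContinuousLinearMap.le_of_opNorm_le_of_le _ bYX
    ((Z' u - Z' s).le_of_opNorm_le_of_le bZ' bX2)
  have c2 := ContinuousLinearMap.le_of_opNorm_le_of_le _ bYX bRZ
  have c3 := ContinuousLinearMap.le_of_opNorm_le_of_le _ bRY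
    (norm_add_le_of_le ((Z' u).le_of_opNorm_le_of_le bZu bX2) bRZ)
  have c4 := ContinuousLinearMap.le_of_opNorm_le_of_le _
    ((tops.spair_le (Y' u - Y' s) (Z' s)).trans
      (mul_le_mul bY' bZs (norm_nonneg _) (by positivity))) bXX
  have c5 := ContinuousLinearMap.le_of_opNorm_le_of_le _
    ((tops.spair_le (Y' u) (Z' u - Z' s)).trans
      (mul_le_mul bYu bZ' (norm_nonneg _) (by positivity))) bXX
  refine (norm_add_le_of_le (norm_add_le_of_le (norm_add_le_of_le (norm_add_le_of_le c1 c2) c3)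
    c4) c5).trans ?_
  calc _ = ((y0 + y1 * τ) * (x1 ^ 2 * z1 + x1 * z2 + x2 * z1) + y2 * (z0 + z1 * τ) * x1 +
        y1 * (z0 + z1 * τ) * x2 + y2 * z2 * ρ) * ρ ^ 3 := by ring
    _ ≤ ((y0 + y1 * τ) * (x1 ^ 2 * z1 + x1 * z2 + x2 * z1) + y2 * (z0 + z1 * τ) * x1 +
        y1 * (z0 + z1 * τ) * x2 + y2 * z2 * τ) * ρ ^ 3 := by gcongr
    _ ≤ _ := by
      gcongr ?_ * ρ ^ 3
      exact defect_coefficient_le hx1 hx2 hy0 hy1 hy2 hz0 hz1 hz2 hτ hτ2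

/-- refinement estimate for compensated Riemann sums. -/
theorem stmt3
    {V V2 W U : Type*} [NormedAddCommGroup V] [NormedSpace ℝ V] [CompleteSpace V]
    [NormedAddCommGroup V2] [NormedSpace ℝ V2] [CompleteSpace V2]
    [NormedAddCommGroup W] [NormedSpace ℝ W] [CompleteSpace W]
    [NormedAddCommGroup U] [NormedSpace ℝ U] [CompleteSpace U]
    (T α : ℝ) (hT : 0 < T) (hα : 1 / 3 < α) (hα' : α ≤ 1 / 2)
    (tops : TensorOps V V2 W U) (X : ℝ → V) (XX : ℝ → ℝ → V2)
    (hX : IsRoughPath T α tops.tmul X XX)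
    (Y : ℝ → W →L[ℝ] U) (Y' : ℝ → V →L[ℝ] (W →L[ℝ] U)) (hY : IsCRP T α X Y Y')
    (Z : ℝ → W) (Z' : ℝ → V →L[ℝ] W) (hZ : IsCRP T α X Z Z')
    (s t : ℝ) (hs : 0 ≤ s) (hst : s ≤ t) (htT : t ≤ T)
    (n : ℕ) (p : ℕ → ℝ) (hp : IsPartition s t n p)
    (n' : ℕ) (p' : ℕ → ℝ) (hp' : IsPartition s t n' p')
    (href : ∀ i ≤ n, ∃ k ≤ n', p' k = p i)
    (m : ℝ) (hm : ∀ i < n, p (i + 1) - p i ≤ m) :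
    ‖rsum tops XX Y Y' Z Z' n' p' - rsum tops XX Y Y' Z Z' n p‖ ≤
      Calpha T α * (‖Y' 0‖ + crpNorm T α X Y Y') * (‖Z' 0‖ + crpNorm T α X Z Z') *
        (1 + rpNorm T α X XX) ^ 2 * m ^ (3 * α - 1) * (t - s) := by
  have h := norm_sum_refinement_sub_le
    (Ξ := fun a b => Y a (Z b - Z a) + tops.spair (Y' a) (Z' a) (XX a b)) (θ := 3 * α)
    (K := (1 + T ^ α + T ^ (2 * α)) * (‖Y' 0‖ + crpNorm T α X Y Y') *
      (‖Z' 0‖ + crpNorm T α X Z Z') * (1 + rpNorm T α X XX) ^ 2)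
    (by
      have hcrpY : 0 ≤ crpNorm T α X Y Y' := add_nonneg (hnorm_nonneg _ _ _) (hnorm_nonneg _ _ _)
      have hcrpZ : 0 ≤ crpNorm T α X Z Z' := add_nonneg (hnorm_nonneg _ _ _) (hnorm_nonneg _ _ _)
      positivity)
    (by linarith)
    (fun a u b ha hau hub hb => norm_compensated_defect_le (by linarith) tops hX hY hZ
      (hs.trans ha) hau hub (hb.trans htT))
    hp hp' href hm
  refine h.trans_eq ?_
  rw [Calpha]
  ring
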